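/- Let F be a forest with n vertices whose connected components T_1, …, T_t satisfy T_i ∈ S_{k_i, l_i} with k_i + l_i ≥ 2 for each i. Then there exists a greedy sequence (Â_p)_{p=0}^{n} for the 1-hop dom on F and an integer d such that ext(Â_p) ≥ ((6e − 5)/(4e − 5)) · p for all 1 ≤ p ≤ d, and ext(Â_p) ≥ ((6e − 5)/(6e + 5)) · (n − p) for all d < p ≤ n. -/

import Mathlib

open Finset
open scoped Classical

/-- The closed `k`-neighborhood of `v`: all vertices at graph distance at most `k`
from `v` (in particular `v` itself). -/
noncomputable def kNbhd {V : Type*} [Fintype V] (G : SimpleGraph V) (k : ℕ) (v : V) :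
    Finset V :=
  Finset.univ.filter (fun u => G.Reachable u v ∧ G.dist u v ≤ k)

/-- `domk G k A` is the number of vertices `k`-hop dominated by `A`. -/
noncomputable def domk {V : Type*} [Fintype V] (G : SimpleGraph V) (k : ℕ) (A : Finset V) :
    ℕ :=
  (A.biUnion (kNbhd G k)).card

/-- `extk G k A` is the number of vertices externally `k`-hop dominated by `A`. -/
noncomputable def extk {V : Type*} [Fintype V] (G : SimpleGraph V) (k : ℕ) (A : Finset V) :
    ℤ :=
  (domk G k A : ℤ) - (A.card : ℤ)

/-- A greedy sequence for `domk G k` (with `N` greedy steps): `A 0 = ∅` and each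
`A (i+1)` is obtained from `A i` by inserting a new vertex maximizing `domk`. -/
def IsGreedySeq {V : Type*} [Fintype V] (G : SimpleGraph V) (k : ℕ) (N : ℕ)
    (A : ℕ → Finset V) : Prop :=
  A 0 = ∅ ∧ ∀ i < N, ∃ v ∉ A i, A (i + 1) = insert v (A i) ∧
    ∀ u ∉ A i, domk G k (insert u (A i)) ≤ domk G k (insert v (A i))

/-- The connected component of `c` in `F` is a tree of the family `S_{a,b}` with
center `c`: every vertex of the component is within distance 2 of `c`, `c` has
`a + b` neighbors, exactly `b` vertices are at distance 2 from `c`, and every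
neighbor of `c` has at most one neighbor other than `c` (in an acyclic graph this
pins the structure of `S_{a,b}`: `a` pendant leaves and `b` legs of length two). -/
def IsSFamilyComponent {V : Type*} [Fintype V] (F : SimpleGraph V) (c : V)
    (a b : ℕ) : Prop :=
  (∀ u : V, F.Reachable c u → F.dist c u ≤ 2) ∧
  (Finset.univ.filter (fun u => F.Adj c u)).card = a + b ∧
  (Finset.univ.filter (fun u => F.dist c u = 2)).card = b ∧
  ∀ w : V, F.Adj c w → (Finset.univ.filter (fun u => F.Adj w u ∧ u ≠ c)).card ≤ 1

section GreedySequences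

variable {V : Type*} [Fintype V]

theorem exists_isGreedySeq_of_invariant (G : SimpleGraph V) (k : ℕ) (P : Finset V → Prop)
    (h0 : P ∅)
    (hstep : ∀ A, P A → A ≠ univ → ∃ v ∉ A, P (insert v A) ∧
      ∀ u ∉ A, domk G k (insert u A) ≤ domk G k (insert v A)) :
    ∃ A : ℕ → Finset V, IsGreedySeq G k (Fintype.card V) A ∧
      ∀ p ≤ Fintype.card V, P (A p) ∧ (A p).card = p := by
  have hstep' : ∀ A, P A → A ≠ univ → ∃ B, P B ∧ ∃ v ∉ A, B = insert v A ∧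
      ∀ u ∉ A, domk G k (insert u A) ≤ domk G k (insert v A) := by
    intro A hA hne
    obtain ⟨v, hv, hP, hmax⟩ := hstep A hA hne
    exact ⟨insert v A, hP, v, hv, rfl, hmax⟩
  choose! next hnext using hstep'
  let A : ℕ → Finset V := fun p => Nat.rec ∅ (fun _ B => next B) p
  have hproper : ∀ p < Fintype.card V, (A p).card = p → A p ≠ univ := by
    intro p hp hcard h
    rw [h, card_univ] at hcard
    omega
  have hA : ∀ p ≤ Fintype.card V, P (A p) ∧ (A p).card = p := by
    intro p
    induction p with
    | zero => exact fun _ => ⟨h0, card_empty⟩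
    | succ p ih =>
      intro hp
      obtain ⟨hP, hcard⟩ := ih (by omega)
      obtain ⟨hP', v, hv, heq, -⟩ := hnext (A p) hP (hproper p hp hcard)
      have hsucc : A (p + 1) = insert v (A p) := heq
      exact ⟨hP', by rw [hsucc, card_insert_of_notMem hv, hcard]⟩
  refine ⟨A, ⟨rfl, fun i hi => ?_⟩, hA⟩
  obtain ⟨hP, hcard⟩ := hA i hi.le
  exact (hnext (A i) hP (hproper i hi hcard)).2

/-- The number of vertices newly dominated by adding `v` to `A`. -/
noncomputable def newlyDominated (G : SimpleGraph V) (k : ℕ) (A : Finset V) (v : V) : ℕ :=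
  (kNbhd G k v \ A.biUnion (kNbhd G k)).card

theorem domk_insert (G : SimpleGraph V) (k : ℕ) (A : Finset V) (v : V) :
    domk G k (insert v A) = domk G k A + newlyDominated G k A v := by
  rw [domk, domk, newlyDominated, biUnion_insert, ← sdiff_union_self_eq_union,
    card_union_of_disjoint sdiff_disjoint, add_comm]

theorem newlyDominated_eq_zero {G : SimpleGraph V} {k : ℕ} {A : Finset V} {v : V} (hv : v ∈ A) :
    newlyDominated G k A v = 0 := by
  rw [newlyDominated, card_eq_zero, sdiff_eq_empty_iff_subset]
  exact subset_biUnion_of_mem _ hv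

theorem self_mem_kNbhd (G : SimpleGraph V) (k : ℕ) (v : V) : v ∈ kNbhd G k v := by
  simp [kNbhd]

theorem domk_le_card (G : SimpleGraph V) (k : ℕ) (A : Finset V) :
    domk G k A ≤ Fintype.card V :=
  card_le_univ _

theorem exists_newlyDominated_pos {G : SimpleGraph V} {k : ℕ} {A : Finset V}
    (h : domk G k A < Fintype.card V) : ∃ v ∉ A, 0 < newlyDominated G k A v := by
  obtain ⟨v, hv⟩ : ∃ v, v ∉ A.biUnion (kNbhd G k) := by
    by_contra! hall
    rw [domk, eq_univ_of_forall hall, card_univ] at h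
    exact lt_irrefl _ h
  refine ⟨v, fun hvA => hv (mem_biUnion.2 ⟨v, hvA, self_mem_kNbhd G k v⟩), ?_⟩
  exact card_pos.2 ⟨v, mem_sdiff.2 ⟨self_mem_kNbhd G k v, hv⟩⟩

/-- If every component `i` has a root `r i` of maximum closed neighborhood, outside of which every
vertex dominates at most two vertices, and for `i ∈ Q` a second vertex `s i` attains this bound,
then some greedy sequence takes first the roots, then the vertices `s i`, and its external
domination is bounded accordingly. -/
theorem exists_isGreedySeq_of_roots (G : SimpleGraph V) (k : ℕ) {ι : Type*} [Fintype ι]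
    (comp : V → ι) (r s : ι → V) (Q : Finset ι)
    (hcomp : ∀ u v, u ∈ kNbhd G k v → comp u = comp v)
    (hr : ∀ i, comp (r i) = i) (hs : ∀ i ∈ Q, comp (s i) = i)
    (hmax : ∀ u, (kNbhd G k u).card ≤ (kNbhd G k (r (comp u))).card)
    (htwo : ∀ u, (kNbhd G k u \ kNbhd G k (r (comp u))).card ≤ 2)
    (hsecond : ∀ i ∈ Q, (kNbhd G k (s i) \ kNbhd G k (r i)).card = 2)
    (hthree : ∀ i, 3 ≤ (kNbhd G k (r i)).card)
    (hfive : Fintype.card V + 10 * Fintype.card ι ≤ 5 * ∑ i, (kNbhd G k (r i)).card)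
    (htwelve : 5 * Fintype.card V + 12 * Fintype.card ι ≤
      12 * ∑ i, (kNbhd G k (r i)).card + 12 * Q.card) :
    ∃ A : ℕ → Finset V, IsGreedySeq G k (Fintype.card V) A ∧
      ∀ p ≤ Fintype.card V,
        2 * (p : ℤ) ≤ extk G k (A p) ∨
        5 * (p : ℤ) + Fintype.card V ≤ 5 * extk G k (A p) ∨
        5 * (Fintype.card V : ℤ) ≤ 12 * extk G k (A p) ∨
        (Fintype.card V : ℤ) - p ≤ extk G k (A p) := by
  let rootsPhase : Finset V → Prop := fun A => ∃ I : Finset ι, A = I.image r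
  let secondPhase : Finset V → Prop := fun A => ∃ J ⊆ Q, A = univ.image r ∪ J.image s ∧
    domk G k A = ∑ i, (kNbhd G k (r i)).card + 2 * J.card
  let finalPhase : Finset V → Prop := fun A =>
    5 * Fintype.card V + 12 * A.card ≤ 12 * domk G k A ∨ domk G k A = Fintype.card V
  have hdisj : ∀ u v, comp u ≠ comp v → Disjoint (kNbhd G k u) (kNbhd G k v) := by
    intro u v huv
    rw [disjoint_left]
    intro x hxu hxv
    exact huv ((hcomp x u hxu).symm.trans (hcomp x v hxv))
  have hdom : ∀ I : Finset ι, domk G k (I.image r) = ∑ i ∈ I, (kNbhd G k (r i)).card := by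
    intro I
    rw [domk, image_biUnion, card_biUnion]
    intro i _ j _ hij
    exact hdisj _ _ (by rwa [hr, hr])
  have hgain_le_two : ∀ (A : Finset V) (u : V), r (comp u) ∈ A → newlyDominated G k A u ≤ 2 := by
    intro A u hu
    refine le_trans (card_le_card ?_) (htwo u)
    exact sdiff_subset_sdiff subset_rfl (subset_biUnion_of_mem _ hu)
  have hgain_le : ∀ (A : Finset V) (u : V),
      newlyDominated G k A u ≤ (kNbhd G k (r (comp u))).card := fun A u =>
    (card_le_card sdiff_subset).trans (hmax u)
  have hgain_root : ∀ (I : Finset ι) (i : ι), i ∉ I →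
      newlyDominated G k (I.image r) (r i) = (kNbhd G k (r i)).card := by
    intro I i hi
    have h := domk_insert G k (I.image r) (r i)
    rw [← image_insert, hdom, hdom, sum_insert hi] at h
    omega
  have hgain_second : ∀ J ⊆ Q, ∀ j ∈ Q, j ∉ J →
      newlyDominated G k (univ.image r ∪ J.image s) (s j) = 2 := by
    intro J hJ j hjQ hj
    rw [newlyDominated, ← hsecond j hjQ]
    congr 1
    ext x
    simp only [mem_sdiff, mem_biUnion, mem_union, mem_image, mem_univ, true_and]
    refine and_congr_right fun hx => not_congr ⟨?_, fun h => ⟨r j, Or.inl ⟨j, rfl⟩, h⟩⟩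
    have hxj : comp x = j := (hcomp _ _ hx).trans (hs j hjQ)
    rintro ⟨y, ⟨i, rfl⟩ | ⟨i, hi, rfl⟩, hxy⟩
    · have : i = j := by rw [← hxj, hcomp _ _ hxy, hr]
      rwa [← this]
    · have : i = j := by rw [← hxj, hcomp _ _ hxy, hs i (hJ hi)]
      exact absurd (this ▸ hi) hj
  have hfinal_step : ∀ A, finalPhase A → A ≠ univ → ∃ v ∉ A, finalPhase (insert v A) ∧
      ∀ u ∉ A, domk G k (insert u A) ≤ domk G k (insert v A) := by
    intro A hA hne
    have hne' : (Aᶜ).Nonempty := by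
      rwa [nonempty_iff_ne_empty, Ne, compl_eq_empty_iff]
    obtain ⟨v, hv, hvmax⟩ := exists_max_image Aᶜ (fun u => domk G k (insert u A)) hne'
    rw [mem_compl] at hv
    refine ⟨v, hv, ?_, fun u hu => hvmax u (mem_compl.2 hu)⟩
    have hle := domk_le_card G k (insert v A)
    have hins := domk_insert G k A v
    by_cases hfull : domk G k A = Fintype.card V
    · exact Or.inr (by omega)
    · obtain ⟨u, hu, hpos⟩ :=
        exists_newlyDominated_pos (lt_of_le_of_ne (domk_le_card G k A) hfull)
      have hu' := hvmax u (mem_compl.2 hu)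
      simp only [domk_insert] at hu'
      refine Or.inl ?_
      rw [card_insert_of_notMem hv]
      rcases hA with hA | hA <;> omega
  have hsecond_step : ∀ A, secondPhase A → A ≠ univ →
      ∃ v ∉ A, (secondPhase (insert v A) ∨ finalPhase (insert v A)) ∧
        ∀ u ∉ A, domk G k (insert u A) ≤ domk G k (insert v A) := by
    rintro A ⟨J, hJ, rfl, hdomA⟩ hne
    by_cases hJQ : J = Q
    · have hcard : (univ.image r ∪ J.image s).card ≤ Fintype.card ι + J.card :=
        (card_union_le _ _).trans (add_le_add card_image_le card_image_le)
      obtain ⟨v, hv, hP, hvmax⟩ := hfinal_step _ (Or.inl (by subst hJQ; omega)) hne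
      exact ⟨v, hv, Or.inr hP, hvmax⟩
    · obtain ⟨j, hjQ, hj⟩ := exists_of_ssubset (hJ.ssubset_of_ne hJQ)
      have hg := hgain_second J hJ j hjQ hj
      refine ⟨s j, fun h => ?_, Or.inl ⟨insert j J, insert_subset hjQ hJ, ?_, ?_⟩, fun u _ => ?_⟩
      · rw [newlyDominated_eq_zero h] at hg
        omega
      · rw [image_insert, union_insert]
      · rw [domk_insert, hg, hdomA, card_insert_of_notMem hj]
        ring
      · rw [domk_insert, domk_insert, hg]
        exact Nat.add_le_add_left
          (hgain_le_two _ u (mem_union_left _ (mem_image_of_mem r (mem_univ _)))) _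
  have hroots_step : ∀ A, rootsPhase A → A ≠ univ →
      ∃ v ∉ A, (rootsPhase (insert v A) ∨ secondPhase (insert v A) ∨ finalPhase (insert v A)) ∧
        ∀ u ∉ A, domk G k (insert u A) ≤ domk G k (insert v A) := by
    rintro A ⟨I, rfl⟩ hne
    by_cases hI : I = univ
    · obtain ⟨v, hv, hP, hvmax⟩ := hsecond_step (I.image r)
        ⟨∅, empty_subset _, by simp [hI], by simp [hdom, hI]⟩ hne
      exact ⟨v, hv, Or.inr hP, hvmax⟩
    · have hne' : (Iᶜ).Nonempty := by
        rwa [nonempty_iff_ne_empty, Ne, compl_eq_empty_iff]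
      obtain ⟨i, hi, himax⟩ := exists_max_image Iᶜ (fun i => (kNbhd G k (r i)).card) hne'
      have hg := hgain_root I i (mem_compl.1 hi)
      have h3 := hthree i
      refine ⟨r i, fun h => ?_, Or.inl ⟨insert i I, (image_insert r i I).symm⟩, fun u _ => ?_⟩
      · rw [newlyDominated_eq_zero h] at hg
        omega
      · rw [domk_insert, domk_insert, hg]
        refine Nat.add_le_add_left ?_ _
        by_cases hu : comp u ∈ I
        · exact (hgain_le_two _ u (mem_image_of_mem r hu)).trans (by omega)
        · exact (hgain_le _ u).trans (himax _ (mem_compl.2 hu))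
  obtain ⟨A, hA, hAP⟩ := exists_isGreedySeq_of_invariant G k
    (fun A => rootsPhase A ∨ secondPhase A ∨ finalPhase A) (Or.inl ⟨∅, (image_empty r).symm⟩) (by
      rintro A (h | h | h) hne
      · exact hroots_step A h hne
      · obtain ⟨v, hv, hP, hvmax⟩ := hsecond_step A h hne
        exact ⟨v, hv, Or.inr hP, hvmax⟩
      · obtain ⟨v, hv, hP, hvmax⟩ := hfinal_step A h hne
        exact ⟨v, hv, Or.inr (Or.inr hP), hvmax⟩)
  refine ⟨A, hA, fun p hp => ?_⟩
  obtain ⟨hP, hcard⟩ := hAP p hp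
  rw [extk, hcard]
  rcases hP with ⟨I, hI⟩ | ⟨J, -, hJ, hdomJ⟩ | hfin | hfin
  · left
    have h3 : 3 * I.card ≤ domk G k (A p) := by
      rw [hI, hdom, mul_comm, ← smul_eq_mul]
      exact card_nsmul_le_sum _ _ _ fun i _ => hthree i
    have hp' : p ≤ I.card := by
      rw [← hcard, hI]
      exact card_image_le
    omega
  · right; left
    have hp' : p ≤ Fintype.card ι + J.card := by
      rw [← hcard, hJ]
      exact (card_union_le _ _).trans (add_le_add card_image_le card_image_le)
    omega
  · right; right; left
    omega
  · right; right; right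
    omega

end GreedySequences

/-- The lower bounds by the two lines `α p` and `β (n - p)` follow from the bounds of the
successive phases, since these lines meet at `p = (4e - 5) / (10e) * n`. -/
theorem exists_breakpoint (n : ℕ) (E : ℕ → ℤ)
    (hE : ∀ p ≤ n, 2 * (p : ℤ) ≤ E p ∨ 5 * (p : ℤ) + n ≤ 5 * E p ∨
      5 * (n : ℤ) ≤ 12 * E p ∨ (n : ℤ) - p ≤ E p) :
    ∃ d : ℕ,
      (∀ p : ℕ, 1 ≤ p → p ≤ d →
        (6 * Real.exp 1 - 5) / (4 * Real.exp 1 - 5) * (p : ℝ) ≤ (E p : ℝ)) ∧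
      (∀ p : ℕ, d < p → p ≤ n →
        (6 * Real.exp 1 - 5) / (6 * Real.exp 1 + 5) * ((n : ℝ) - p) ≤ (E p : ℝ)) := by
  have he1 := Real.exp_one_gt_d9
  have he2 := Real.exp_one_lt_d9
  set e := Real.exp 1
  have hn : (0 : ℝ) ≤ n := n.cast_nonneg
  have hE' : ∀ p ≤ n, 2 * (p : ℝ) ≤ E p ∨ 5 * (p : ℝ) + n ≤ 5 * E p ∨
      5 * (n : ℝ) ≤ 12 * E p ∨ (n : ℝ) - p ≤ E p := by
    exact_mod_cast hE
  refine ⟨⌊(4 * e - 5) / (10 * e) * n⌋₊, fun p _ hp => ?_, fun p hp hpn => ?_⟩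
  · have hp' : (p : ℝ) ≤ (4 * e - 5) / (10 * e) * n :=
      (Nat.le_floor_iff (by apply mul_nonneg _ hn; apply div_nonneg <;> linarith)).1 hp
    rw [div_mul_eq_mul_div, le_div_iff₀ (by linarith)] at hp'
    have hp0 : (0 : ℝ) ≤ p := p.cast_nonneg
    have hpn : p ≤ n := by
      have : (p : ℝ) ≤ n := by nlinarith
      exact_mod_cast this
    rw [div_mul_eq_mul_div, div_le_iff₀ (by linarith)]
    rcases hE' p hpn with h | h | h | h
    · nlinarith
    · nlinarith
    · nlinarith
    · nlinarith
  · have hp' : (4 * e - 5) / (10 * e) * n ≤ p := (Nat.lt_of_floor_lt hp).le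
    rw [div_mul_eq_mul_div, div_le_iff₀ (by linarith)] at hp'
    have hp0 : (0 : ℝ) ≤ n - p := by
      have : (p : ℝ) ≤ n := by exact_mod_cast hpn
      linarith
    rw [div_mul_eq_mul_div, div_le_iff₀ (by linarith)]
    rcases hE' p hpn with h | h | h | h
    · nlinarith
    · nlinarith
    · nlinarith
    · nlinarith

theorem exists_adj_adj_of_dist_eq_two {V : Type*} {F : SimpleGraph V} {c v : V}
    (h : F.dist c v = 2) : ∃ w, F.Adj c w ∧ F.Adj w v := by
  have hr : F.Reachable c v := SimpleGraph.Reachable.of_dist_ne_zero (by omega)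
  obtain ⟨p, hp⟩ := hr.exists_walk_length_eq_dist
  rw [h] at hp
  match p, hp with
  | .cons h₁ (.cons h₂ .nil), _ => exact ⟨_, h₁, h₂⟩

/-- In a forest, two vertices have at most one common neighbor. -/
theorem SimpleGraph.IsAcyclic.eq_of_common_neighbor {V : Type*} {F : SimpleGraph V}
    (hF : F.IsAcyclic) {c v x y : V} (hcv : c ≠ v) (hcx : F.Adj c x) (hxv : F.Adj x v)
    (hcy : F.Adj c y) (hyv : F.Adj y v) : x = y := by
  have key : ∀ {z : V} (h₁ : F.Adj c z) (h₂ : F.Adj z v),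
      (SimpleGraph.Walk.cons h₁ (.cons h₂ .nil)).IsPath := by
    intro z h₁ h₂
    simp [SimpleGraph.Walk.cons_isPath_iff, h₁.ne, h₂.ne, hcv]
  have h := congrArg (fun p : F.Path c v => p.1.snd)
    ((hF.subsingleton_path c v).elim ⟨_, key hcx hxv⟩ ⟨_, key hcy hyv⟩)
  simpa using h

section SFamily

variable {V : Type*} [Fintype V] {F : SimpleGraph V} {c : V} {a b : ℕ}

theorem mem_kNbhd_one {u v : V} : u ∈ kNbhd F 1 v ↔ u = v ∨ F.Adj v u := by
  simp only [kNbhd, mem_filter, mem_univ, true_and]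
  constructor
  · rintro ⟨hr, hd⟩
    rcases Nat.le_one_iff_eq_zero_or_eq_one.1 hd with h | h
    · exact Or.inl (hr.dist_eq_zero_iff.1 h)
    · exact Or.inr (SimpleGraph.dist_eq_one_iff_adj.1 h).symm
  · rintro (rfl | h)
    · simp
    · exact ⟨h.symm.reachable, (SimpleGraph.dist_eq_one_iff_adj.2 h.symm).le⟩

theorem kNbhd_one_eq_insert (v : V) : kNbhd F 1 v = insert v (univ.filter fun u => F.Adj v u) := by
  ext u
  simp [mem_kNbhd_one]

theorem card_kNbhd_one (v : V) :
    (kNbhd F 1 v).card = (univ.filter fun u => F.Adj v u).card + 1 := by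
  rw [kNbhd_one_eq_insert, card_insert_of_notMem (by simp)]

theorem kNbhd_one_subset (c w : V) :
    kNbhd F 1 w ⊆ insert w (insert c (univ.filter fun u => F.Adj w u ∧ u ≠ c)) := by
  intro u hu
  simp only [mem_insert, mem_filter, mem_univ, true_and]
  rcases mem_kNbhd_one.1 hu with rfl | hu
  · exact Or.inl rfl
  · by_cases huc : u = c
    · exact Or.inr (Or.inl huc)
    · exact Or.inr (Or.inr ⟨hu, huc⟩)

namespace IsSFamilyComponent

theorem dist_le_two (h : IsSFamilyComponent F c a b) {u : V} (hu : F.Reachable c u) :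
    F.dist c u ≤ 2 := h.1 u hu

theorem card_filter_adj (h : IsSFamilyComponent F c a b) :
    (univ.filter fun u => F.Adj c u).card = a + b := h.2.1

theorem card_filter_dist_eq_two (h : IsSFamilyComponent F c a b) :
    (univ.filter fun u => F.dist c u = 2).card = b := h.2.2.1

theorem card_filter_adj_ne_le_one (h : IsSFamilyComponent F c a b) {w : V} (hw : F.Adj c w) :
    (univ.filter fun u => F.Adj w u ∧ u ≠ c).card ≤ 1 := h.2.2.2 w hw

theorem eq_or_adj_or_dist_eq_two (h : IsSFamilyComponent F c a b) {u : V}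
    (hu : F.Reachable c u) : u = c ∨ F.Adj c u ∨ F.dist c u = 2 := by
  have h2 := h.dist_le_two hu
  interval_cases hd : F.dist c u
  · exact Or.inl (hu.dist_eq_zero_iff.1 hd).symm
  · exact Or.inr (Or.inl (SimpleGraph.dist_eq_one_iff_adj.1 hd))
  · exact Or.inr (Or.inr rfl)

theorem card_filter_reachable (h : IsSFamilyComponent F c a b) :
    (univ.filter fun u => F.Reachable c u).card = 1 + a + 2 * b := by
  have heq : (univ.filter fun u => F.Reachable c u) =
      kNbhd F 1 c ∪ univ.filter fun u => F.dist c u = 2 := by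
    ext u
    simp only [mem_filter, mem_univ, true_and, mem_union, mem_kNbhd_one]
    constructor
    · intro hu
      rw [or_assoc]
      exact h.eq_or_adj_or_dist_eq_two hu
    · rintro ((rfl | hu) | hu)
      · exact SimpleGraph.Reachable.refl u
      · exact hu.reachable
      · exact SimpleGraph.Reachable.of_dist_ne_zero (by omega)
  rw [heq, card_union_of_disjoint, card_kNbhd_one, h.card_filter_adj, h.card_filter_dist_eq_two]
  · omega
  · rw [disjoint_left]
    intro u hu hu2
    simp only [mem_filter, mem_univ, true_and] at hu2
    rcases mem_kNbhd_one.1 hu with rfl | hu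
    · simp at hu2
    · rw [SimpleGraph.dist_eq_one_iff_adj.2 hu] at hu2
      omega

theorem card_kNbhd_center (h : IsSFamilyComponent F c a b) :
    (kNbhd F 1 c).card = a + b + 1 := by
  rw [card_kNbhd_one, h.card_filter_adj]

theorem card_kNbhd_of_adj_le (h : IsSFamilyComponent F c a b) {w : V} (hw : F.Adj c w) :
    (kNbhd F 1 w).card ≤ 3 := by
  have h1 := h.card_filter_adj_ne_le_one hw
  have h2 := card_le_card (kNbhd_one_subset (F := F) c w)
  have h3 := card_insert_le w (insert c (univ.filter fun u => F.Adj w u ∧ u ≠ c))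
  have h4 := card_insert_le c (univ.filter fun u => F.Adj w u ∧ u ≠ c)
  omega

theorem card_kNbhd_of_adj_sdiff_le (h : IsSFamilyComponent F c a b) {w : V} (hw : F.Adj c w) :
    (kNbhd F 1 w \ kNbhd F 1 c).card ≤ 1 := by
  refine (card_le_card fun u hu => ?_).trans (h.card_filter_adj_ne_le_one hw)
  rw [mem_sdiff, mem_kNbhd_one, mem_kNbhd_one, not_or] at hu
  rw [mem_filter]
  refine ⟨mem_univ _, hu.1.resolve_left ?_, hu.2.1⟩
  rintro rfl
  exact hu.2.2 hw

theorem card_kNbhd_of_dist_eq_two_le (h : IsSFamilyComponent F c a b) (hF : F.IsAcyclic) {v : V}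
    (hv : F.dist c v = 2) : (kNbhd F 1 v).card ≤ 2 := by
  have hr : F.Reachable c v := SimpleGraph.Reachable.of_dist_ne_zero (by omega)
  have hcv : c ≠ v := by
    rintro rfl
    simp at hv
  have hadj : ∀ x, F.Adj v x → F.Adj c x := by
    intro x hx
    have h2 := h.dist_le_two (hr.trans hx.reachable)
    have hne := hF.dist_ne_of_adj hx hr
    have hcx : c ≠ x := by
      rintro rfl
      rw [SimpleGraph.dist_eq_one_iff_adj.2 hx.symm] at hv
      omega
    have hpos := (hr.trans hx.reachable).pos_dist_of_ne hcx
    exact SimpleGraph.dist_eq_one_iff_adj.1 (by omega)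
  rw [card_kNbhd_one]
  refine Nat.succ_le_succ (card_le_one.2 fun x hx y hy => ?_)
  simp only [mem_filter, mem_univ, true_and] at hx hy
  exact hF.eq_of_common_neighbor hcv (hadj x hx) hx.symm (hadj y hy) hy.symm

theorem card_kNbhd_le (h : IsSFamilyComponent F c a b) (hF : F.IsAcyclic) (hab : 2 ≤ a + b)
    {u : V} (hu : F.Reachable c u) : (kNbhd F 1 u).card ≤ a + b + 1 := by
  rcases h.eq_or_adj_or_dist_eq_two hu with rfl | hu | hu
  · exact h.card_kNbhd_center.le
  · exact (h.card_kNbhd_of_adj_le hu).trans (by omega)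
  · exact (h.card_kNbhd_of_dist_eq_two_le hF hu).trans (by omega)

theorem card_kNbhd_sdiff_center_le (h : IsSFamilyComponent F c a b) (hF : F.IsAcyclic)
    {u : V} (hu : F.Reachable c u) : (kNbhd F 1 u \ kNbhd F 1 c).card ≤ 2 := by
  rcases h.eq_or_adj_or_dist_eq_two hu with rfl | hu | hu
  · simp
  · exact (h.card_kNbhd_of_adj_sdiff_le hu).trans (by omega)
  · exact (card_le_card sdiff_subset).trans (h.card_kNbhd_of_dist_eq_two_le hF hu)

theorem card_kNbhd_sdiff_le (h : IsSFamilyComponent F c a b) {u w : V} (hu : F.Reachable c u)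
    (hw : F.Reachable c w) : (kNbhd F 1 u \ kNbhd F 1 w).card + (kNbhd F 1 w).card ≤
      1 + a + 2 * b := by
  have hsub : ∀ {x}, F.Reachable c x → kNbhd F 1 x ⊆ univ.filter fun y => F.Reachable c y := by
    intro x hx y hy
    rw [mem_filter]
    rcases mem_kNbhd_one.1 hy with rfl | hy
    · exact ⟨mem_univ _, hx⟩
    · exact ⟨mem_univ _, hx.trans hy.reachable⟩
  rw [← h.card_filter_reachable, ← card_union_of_disjoint sdiff_disjoint,
    sdiff_union_self_eq_union]
  exact card_le_card (union_subset (hsub hu) (hsub hw))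

/-- In a path on five vertices, the two neighbors of the center dominate everything, and each of
them dominates three vertices. -/
theorem exists_pair_of_path (h : IsSFamilyComponent F c 0 2) :
    ∃ w w', F.Adj c w ∧ F.Adj c w' ∧ (kNbhd F 1 w).card = 3 ∧
      (kNbhd F 1 w' \ kNbhd F 1 w).card = 2 := by
  obtain ⟨v, v', hvv', hv2⟩ := card_eq_two.1 h.card_filter_dist_eq_two
  have hv : F.dist c v = 2 := by
    have : v ∈ univ.filter fun u => F.dist c u = 2 := by simp [hv2]
    simpa using this
  have hv' : F.dist c v' = 2 := by
    have : v' ∈ univ.filter fun u => F.dist c u = 2 := by simp [hv2]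
    simpa using this
  obtain ⟨w, hcw, hwv⟩ := exists_adj_adj_of_dist_eq_two hv
  obtain ⟨w', hcw', hwv'⟩ := exists_adj_adj_of_dist_eq_two hv'
  have hne : ∀ {x}, F.dist c x = 2 → x ≠ c ∧ ¬ F.Adj c x := by
    intro x hx
    constructor
    · rintro rfl
      simp at hx
    · intro hadj
      rw [SimpleGraph.dist_eq_one_iff_adj.2 hadj] at hx
      omega
  have hww' : ∀ {x}, F.Adj c x → F.Adj x v → F.Adj x v' → False := by
    intro x hcx h1 h2
    refine hvv' (card_le_one.1 (h.card_filter_adj_ne_le_one hcx) v ?_ v' ?_)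
    · simp [h1, (hne hv).1]
    · simp [h2, (hne hv').1]
  have hww : w ≠ w' := by
    rintro rfl
    exact hww' hcw hwv hwv'
  have hw3 : 3 ≤ (kNbhd F 1 w).card := by
    have hsub : ({w, c, v} : Finset V) ⊆ kNbhd F 1 w := by
      intro x hx
      simp only [mem_insert, mem_singleton] at hx
      rw [mem_kNbhd_one]
      rcases hx with rfl | rfl | rfl
      · exact Or.inl rfl
      · exact Or.inr hcw.symm
      · exact Or.inr hwv
    refine le_trans (le_of_eq ?_) (card_le_card hsub)
    rw [card_eq_three.2 ⟨w, c, v, hcw.ne', hwv.ne, (hne hv).1.symm, rfl⟩]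
  refine ⟨w, w', hcw, hcw', le_antisymm (h.card_kNbhd_of_adj_le hcw) hw3, ?_⟩
  have hle := h.card_kNbhd_sdiff_le hcw'.reachable hcw.reachable
  refine le_antisymm (by omega) ?_
  rw [← card_pair hwv'.ne]
  refine card_le_card fun x hx => ?_
  rw [mem_sdiff, mem_kNbhd_one, mem_kNbhd_one, not_or]
  rcases mem_insert.1 hx with rfl | hx
  · refine ⟨Or.inl rfl, hww.symm, fun hadj => (hne hv).2 ?_⟩
    rwa [card_le_one.1 (h.card_filter_adj_ne_le_one hcw) v (by simp [hwv, (hne hv).1]) x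
      (by simp [hadj, hcw'.ne'])]
  · rw [mem_singleton.1 hx]
    refine ⟨Or.inr hwv', ?_, fun hadj => hww' hcw hwv hadj⟩
    rintro rfl
    exact (hne hv').2 hcw

/-- A greedy choice of the first two dominating vertices in a component. -/
theorem exists_roots (h : IsSFamilyComponent F c a b) (hF : F.IsAcyclic) (hab : 2 ≤ a + b) :
    ∃ r s, F.Reachable c r ∧ F.Reachable c s ∧ (kNbhd F 1 r).card = a + b + 1 ∧
      (∀ u, F.Reachable c u → (kNbhd F 1 u \ kNbhd F 1 r).card ≤ 2) ∧
      (a = 0 ∧ b = 2 → (kNbhd F 1 s \ kNbhd F 1 r).card = 2) := by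
  by_cases hpath : a = 0 ∧ b = 2
  · obtain ⟨rfl, rfl⟩ := hpath
    obtain ⟨w, w', hw, hw', h3, h2⟩ := h.exists_pair_of_path
    refine ⟨w, w', hw.reachable, hw'.reachable, h3, fun u hu => ?_, fun _ => h2⟩
    have hle := h.card_kNbhd_sdiff_le hu hw.reachable
    omega
  · exact ⟨c, c, .refl c, .refl c, h.card_kNbhd_center,
      fun u hu => h.card_kNbhd_sdiff_center_le hF hu, fun hp => absurd hp hpath⟩

end IsSFamilyComponent

end SFamily

/-- on a forest whose components are trees `T_i ∈ S_{k_i, l_i}` with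
`k_i + l_i ≥ 2`, some greedy sequence for 1-hop domination satisfies the stated
external-domination lower bounds up to a breakpoint `d`. -/
theorem greedy_ext_on_S_family_forest {V : Type*} [Fintype V]
    (F : SimpleGraph V) (hF : F.IsAcyclic) (t : ℕ)
    (c : Fin t → V) (a l : Fin t → ℕ)
    (hcomp : ∀ v : V, ∃! i : Fin t, F.Reachable (c i) v)
    (hS : ∀ i : Fin t, IsSFamilyComponent F (c i) (a i) (l i))
    (hmin : ∀ i : Fin t, 2 ≤ a i + l i) :
    ∃ A : ℕ → Finset V, IsGreedySeq F 1 (Fintype.card V) A ∧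
      ∃ d : ℕ,
        (∀ p : ℕ, 1 ≤ p → p ≤ d →
          (6 * Real.exp 1 - 5) / (4 * Real.exp 1 - 5) * (p : ℝ) ≤
            (extk F 1 (A p) : ℝ)) ∧
        (∀ p : ℕ, d < p → p ≤ Fintype.card V →
          (6 * Real.exp 1 - 5) / (6 * Real.exp 1 + 5) * ((Fintype.card V : ℝ) - p) ≤
            (extk F 1 (A p) : ℝ)) := by
  choose comp hreach huniq using hcomp
  replace huniq : ∀ {v i}, F.Reachable (c i) v → comp v = i := fun h => (huniq _ _ h).symm
  choose r s hr hs hcard htwo hsecond using fun i => (hS i).exists_roots hF (hmin i)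
  let Q : Finset (Fin t) := univ.filter fun i => a i = 0 ∧ l i = 2
  have hQ : Q.card = ∑ i, if a i = 0 ∧ l i = 2 then 1 else 0 := card_filter _ _
  have hn : Fintype.card V = ∑ i, (1 + a i + 2 * l i) := by
    rw [← card_univ, card_eq_sum_card_fiberwise (f := comp) (t := univ) fun _ _ => mem_coe.2
      (mem_univ _)]
    refine sum_congr rfl fun i _ => ?_
    rw [← (hS i).card_filter_reachable]
    congr 1
    ext v
    simp only [mem_filter, mem_univ, true_and]
    exact ⟨fun h => h ▸ hreach v, huniq⟩
  obtain ⟨A, hA, hE⟩ := exists_isGreedySeq_of_roots F 1 comp r s Q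
    (fun u v huv => huniq (by
      rcases mem_kNbhd_one.1 huv with rfl | h
      · exact hreach u
      · exact (hreach v).trans h.reachable))
    (fun i => huniq (hr i)) (fun i _ => huniq (hs i))
    (fun u => by
      rw [hcard]
      exact (hS _).card_kNbhd_le hF (hmin _) (hreach u))
    (fun u => htwo _ u (hreach u))
    (fun i hi => hsecond i (mem_filter.1 hi).2)
    (fun i => by
      have := hmin i
      rw [hcard]
      omega)
    (by
      rw [hn, Fintype.card_eq_sum_ones, mul_sum, ← sum_add_distrib, mul_sum]
      refine sum_le_sum fun i _ => ?_
      have := hmin i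
      rw [hcard]
      omega)
    (by
      rw [hn, Fintype.card_eq_sum_ones, hQ, mul_sum, mul_sum, mul_sum, mul_sum,
        ← sum_add_distrib, ← sum_add_distrib]
      refine sum_le_sum fun i _ => ?_
      have := hmin i
      rw [hcard]
      split_ifs <;> omega)
  exact ⟨A, hA, exists_breakpoint _ _ hE⟩
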